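/- Let α be a nonzero real number and let Q be the 3-dimensional real Leibniz algebra with bracket determined by [f,g]=f, [g,e]=αe, [g,f]=−f (all other brackets of basis vectors zero). A linear map N : Q → Q is a Nijenhuis operator on Q if and only if its matrix (rows = coordinates of N(e), N(f), N(g) in the basis {e,f,g}) has one of the following forms for real parameters: (1) rows (k₁,0,0), (ℓ₁,ℓ₂,0), (p₁,p₂,k₁); (2) rows (k₁,0,0), (0,ℓ₂,ℓ₃), (0,p₂,k₁) with ℓ₃≠0; (3) rows (k₁,0,0), (0,ℓ₂,ℓ₃), (0,p₂,p₃) with p₃≠k₁; (4) rows (k₁,k₂,0), (0,ℓ₂,0), (0,p₂,ℓ₂) with k₂≠0. -/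

import Mathlib

/-- Bracket of the 3-dim real Leibniz algebra with [f,g]=f, [g,e]=αe, [g,f]=-f
(basis e,f,g ↔ indices 0,1,2). -/
noncomputable def br (α : ℝ) (x y : Fin 3 → ℝ) : Fin 3 → ℝ :=
  ![α * (x 2 * y 0), x 1 * y 2 - x 2 * y 1, 0]

/-- A linear endomorphism of `ℝ³` in coordinates, from the images of the standard basis. -/
lemma map_eq_of_basis (N : (Fin 3 → ℝ) →ₗ[ℝ] (Fin 3 → ℝ)) {a b c : Fin 3 → ℝ}
    (he : N ![1,0,0] = a) (hf : N ![0,1,0] = b) (hg : N ![0,0,1] = c) (x : Fin 3 → ℝ) :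
    N x = ![x 0 * a 0 + x 1 * b 0 + x 2 * c 0, x 0 * a 1 + x 1 * b 1 + x 2 * c 1,
      x 0 * a 2 + x 1 * b 2 + x 2 * c 2] := by
  have hx : x = x 0 • ![1,0,0] + x 1 • ![0,1,0] + x 2 • ![0,0,1] := by
    ext i; fin_cases i <;> simp
  have hN : N x = x 0 • a + x 1 • b + x 2 • c := by
    conv_lhs => rw [hx]
    simp only [map_add, map_smul, he, hf, hg]
  rw [hN]
  ext i; fin_cases i <;> simp

theorem nijenhuis_classification_thm2_3 (α : ℝ) (hα : α ≠ 0)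
    (N : (Fin 3 → ℝ) →ₗ[ℝ] (Fin 3 → ℝ)) :
    (∀ x y, br α (N x) (N y) + N (N (br α x y)) = N (br α (N x) y) + N (br α x (N y)))
    ↔
    ((∃ k₁ ℓ₁ ℓ₂ p₁ p₂ : ℝ,
        N ![1,0,0] = ![k₁,0,0] ∧ N ![0,1,0] = ![ℓ₁,ℓ₂,0] ∧ N ![0,0,1] = ![p₁,p₂,k₁]) ∨
     (∃ k₁ ℓ₂ ℓ₃ p₂ : ℝ, ℓ₃ ≠ 0 ∧
        N ![1,0,0] = ![k₁,0,0] ∧ N ![0,1,0] = ![0,ℓ₂,ℓ₃] ∧ N ![0,0,1] = ![0,p₂,k₁]) ∨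
     (∃ k₁ ℓ₂ ℓ₃ p₂ p₃ : ℝ, p₃ ≠ k₁ ∧
        N ![1,0,0] = ![k₁,0,0] ∧ N ![0,1,0] = ![0,ℓ₂,ℓ₃] ∧ N ![0,0,1] = ![0,p₂,p₃]) ∨
     (∃ k₁ k₂ ℓ₂ p₂ : ℝ, k₂ ≠ 0 ∧
        N ![1,0,0] = ![k₁,k₂,0] ∧ N ![0,1,0] = ![0,ℓ₂,0] ∧ N ![0,0,1] = ![0,p₂,ℓ₂])) := by
  constructor
  · intro h
    obtain ⟨k₁, k₂, k₃, he⟩ : ∃ k₁ k₂ k₃ : ℝ, N ![1,0,0] = ![k₁,k₂,k₃] :=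
      ⟨_, _, _, (FinVec.etaExpand_eq _).symm⟩
    obtain ⟨ℓ₁, ℓ₂, ℓ₃, hf⟩ : ∃ ℓ₁ ℓ₂ ℓ₃ : ℝ, N ![0,1,0] = ![ℓ₁,ℓ₂,ℓ₃] :=
      ⟨_, _, _, (FinVec.etaExpand_eq _).symm⟩
    obtain ⟨p₁, p₂, p₃, hg⟩ : ∃ p₁ p₂ p₃ : ℝ, N ![0,0,1] = ![p₁,p₂,p₃] :=
      ⟨_, _, _, (FinVec.etaExpand_eq _).symm⟩
    have key := map_eq_of_basis N he hf hg
    have coord : ∀ x y i, _ := fun x y i => congrFun (h x y) i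
    simp only [key, br] at coord
    have ee₂ := coord ![1,0,0] ![1,0,0] 2
    have ef := coord ![1,0,0] ![0,1,0] 1
    have eg₀ := coord ![1,0,0] ![0,0,1] 0
    have eg₁ := coord ![1,0,0] ![0,0,1] 1
    have ff := coord ![0,1,0] ![0,1,0] 0
    have gg₀ := coord ![0,0,1] ![0,0,1] 0
    have gg₁ := coord ![0,0,1] ![0,0,1] 1
    have fg := coord ![0,1,0] ![0,0,1] 0
    have gf := coord ![0,0,1] ![0,1,0] 0
    simp at ee₂ ef eg₀ eg₁ ff gg₀ gg₁ fg gf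
    clear coord key h
    have hk₃ : k₃ = 0 := by grind
    subst hk₃
    rw [he, hf, hg]
    by_cases hk₂ : k₂ = 0
    · subst hk₂
      have hp₁ : p₁ * (p₃ - k₁) = 0 := mul_left_cancel₀ hα (by linear_combination gg₀)
      by_cases hℓ₃ : ℓ₃ = 0
      · subst hℓ₃
        have hℓ₁ : ℓ₁ * (p₃ - k₁) = 0 := by linear_combination -fg
        by_cases hp₃ : p₃ = k₁
        · exact .inl ⟨k₁, ℓ₁, ℓ₂, p₁, p₂, by simp [hp₃]⟩
        · have := sub_ne_zero.2 hp₃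
          exact .inr (.inr (.inl ⟨k₁, ℓ₂, 0, p₂, p₃, hp₃, by simp_all⟩))
      · have hℓ₁ : ℓ₁ = 0 := by grind
        subst hℓ₁
        have hp : p₁ = 0 := by grind
        subst hp
        by_cases hp₃ : p₃ = k₁
        · exact .inr (.inl ⟨k₁, ℓ₂, ℓ₃, p₂, hℓ₃, by simp [hp₃]⟩)
        · exact .inr (.inr (.inl ⟨k₁, ℓ₂, ℓ₃, p₂, p₃, hp₃, by simp⟩))
    · have hℓ₁ : ℓ₁ = 0 := by grind
      have hℓ₃ : ℓ₃ = 0 := by grind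
      have hp₁ : p₁ = 0 := by grind
      have hp₃ : p₃ = ℓ₂ := mul_left_cancel₀ hk₂ (by linear_combination eg₁)
      exact .inr (.inr (.inr ⟨k₁, k₂, ℓ₂, p₂, hk₂, by simp [hℓ₁, hℓ₃, hp₁, hp₃]⟩))
  · rintro (⟨k₁, ℓ₁, ℓ₂, p₁, p₂, he, hf, hg⟩ | ⟨k₁, ℓ₂, ℓ₃, p₂, -, he, hf, hg⟩ |
      ⟨k₁, ℓ₂, ℓ₃, p₂, p₃, -, he, hf, hg⟩ | ⟨k₁, k₂, ℓ₂, p₂, -, he, hf, hg⟩) x y <;>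
    · simp only [map_eq_of_basis N he hf hg, br]
      ext i
      fin_cases i <;> simp <;> ring
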